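/- arXiv:2502.03749 — 2 statements merged into one kernel-verified Lean document; each statement's English description precedes it below -/
import Mathlib

section
/- Let η > 0, let X^k ∈ 𝒫 have strictly positive entries, let X^{k+1} ∈ 𝒫 have strictly positive entries and minimize the function X ↦ ⟨C,X⟩ + η·D_φ(X,X^k) over 𝒫, and let X* ∈ 𝒫 be any minimizer of ⟨C,·⟩ over 𝒫. Then D_φ(X*, X^{k+1}) ≤ D_φ(X*, X^k). -/
open scoped BigOperators

/-- The Boltzmann–Shannon entropy kernel `φ(X) = Σ_{i,j} X_{ij} (log X_{ij} − 1)`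
(with the convention `0 · log 0 = 0`, which agrees with `Real.log 0 = 0`). -/
noncomputable def phi {m n : ℕ} (X : Matrix (Fin m) (Fin n) ℝ) : ℝ :=
  ∑ i, ∑ j, X i j * (Real.log (X i j) - 1)

/-- The Bregman distance associated with `φ`:
`D_φ(X,Y) = φ(X) − φ(Y) − Σ_{i,j} (log Y_{ij}) (X_{ij} − Y_{ij})`. -/
noncomputable def bregman {m n : ℕ} (X Y : Matrix (Fin m) (Fin n) ℝ) : ℝ :=
  phi X - phi Y - ∑ i, ∑ j, Real.log (Y i j) * (X i j - Y i j)

/-- The trace inner product `⟨A,B⟩ = Σ_{i,j} A_{ij} B_{ij}`. -/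
def inprod {m n : ℕ} (A B : Matrix (Fin m) (Fin n) ℝ) : ℝ :=
  ∑ i, ∑ j, A i j * B i j

/-- The transport polytope
`𝒫 = {X : X_{ij} ≥ 0, X e_n = a, Xᵀ e_m = b}` (row sums `a`, column sums `b`). -/
def Pset {m n : ℕ} (a : Fin m → ℝ) (b : Fin n → ℝ) : Set (Matrix (Fin m) (Fin n) ℝ) :=
  {X | (∀ i j, 0 ≤ X i j) ∧ (∀ i, ∑ j, X i j = a i) ∧ (∀ j, ∑ i, X i j = b j)}

section

open Filter Topology

/-- The three-point identity for the Bregman distance. -/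
theorem bregman_three_point {m n : ℕ} (X Y Z : Matrix (Fin m) (Fin n) ℝ) :
    bregman X Z = bregman X Y + bregman Y Z +
      ∑ i, ∑ j, (Real.log (Y i j) - Real.log (Z i j)) * (X i j - Y i j) := by
  simp only [bregman, sub_mul, mul_sub, Finset.sum_sub_distrib]
  ring

/-- The Bregman distance between entrywise positive matrices is nonnegative. -/
theorem bregman_nonneg {m n : ℕ} {X Y : Matrix (Fin m) (Fin n) ℝ}
    (hX : ∀ i j, 0 < X i j) (hY : ∀ i j, 0 < Y i j) : 0 ≤ bregman X Y := by
  simp only [bregman, phi, ← Finset.sum_sub_distrib]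
  refine Finset.sum_nonneg fun i _ => Finset.sum_nonneg fun j _ => ?_
  have hx := hX i j
  have hy := hY i j
  have h := mul_le_mul_of_nonneg_left (Real.log_le_sub_one_of_pos (div_pos hy hx)) hx.le
  rw [Real.log_div hy.ne' hx.ne', mul_sub_one, mul_div_cancel₀ _ hx.ne'] at h
  linarith

/-- The transport polytope is convex. -/
theorem convex_Pset {m n : ℕ} (a : Fin m → ℝ) (b : Fin n → ℝ) : Convex ℝ (Pset a b) := by
  rintro X ⟨hX, hXa, hXb⟩ Y ⟨hY, hYa, hYb⟩ s t hs ht hst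
  refine ⟨fun i j => ?_, fun i => ?_, fun j => ?_⟩
  · simpa using add_nonneg (mul_nonneg hs (hX i j)) (mul_nonneg ht (hY i j))
  · simp [Finset.sum_add_distrib, ← Finset.mul_sum, hXa, hYa, ← add_mul, hst]
  · simp [Finset.sum_add_distrib, ← Finset.mul_sum, hXb, hYb, ← add_mul, hst]

/-- First-order optimality condition for the Bregman proximal step at an entrywise positive
minimizer `Y`, in the direction of a point `X` of the transport polytope. -/
theorem bregman_prox_variational {m n : ℕ} {a : Fin m → ℝ} {b : Fin n → ℝ}
    {C W X Y : Matrix (Fin m) (Fin n) ℝ} {η : ℝ} (hη : 0 < η)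
    (hYP : Y ∈ Pset a b) (hY : ∀ i j, 0 < Y i j)
    (hmin : ∀ Z ∈ Pset a b, inprod C Y + η * bregman Y W ≤ inprod C Z + η * bregman Z W)
    (hXP : X ∈ Pset a b) :
    0 ≤ inprod C X - inprod C Y +
      η * ∑ i, ∑ j, (Real.log (Y i j) - Real.log (W i j)) * (X i j - Y i j) := by
  let Z : ℝ → Matrix (Fin m) (Fin n) ℝ := fun t => (1 - t) • Y + t • X
  have hZ : ∀ t i j, Z t i j = (1 - t) * Y i j + t * X i j := fun t i j => by simp [Z]
  let g : ℝ → ℝ := fun t => inprod C X - inprod C Y +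
      η * ∑ i, ∑ j, (Real.log (Z t i j) - Real.log (W i j)) * (X i j - Y i j)
  have hg0 : g 0 = inprod C X - inprod C Y +
      η * ∑ i, ∑ j, (Real.log (Y i j) - Real.log (W i j)) * (X i j - Y i j) := by
    simp [g, hZ]
  have hcont : ContinuousAt g 0 := by
    have hlog : ∀ i j, ContinuousAt (fun t => Real.log (Z t i j)) 0 := fun i j => by
      refine ContinuousAt.log ?_ (by simpa [hZ] using (hY i j).ne')
      simp only [hZ]
      fun_prop
    fun_prop
  have hpos : ∀ᶠ t in 𝓝[>] (0 : ℝ), 0 ≤ g t := by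
    filter_upwards [Ioo_mem_nhdsGT (zero_lt_one' ℝ)] with t ⟨ht0, ht1⟩
    have hZP : Z t ∈ Pset a b := convex_Pset a b hYP hXP (by linarith) ht0.le (by ring)
    have hZpos : ∀ i j, 0 < Z t i j := fun i j => by
      rw [hZ]
      exact add_pos_of_pos_of_nonneg (mul_pos (by linarith) (hY i j))
        (mul_nonneg ht0.le (hXP.1 i j))
    have hC : inprod C (Z t) = inprod C Y + t * (inprod C X - inprod C Y) := by
      simp only [inprod, hZ, Finset.mul_sum, ← Finset.sum_sub_distrib, ← Finset.sum_add_distrib]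
      refine Finset.sum_congr rfl fun i _ => Finset.sum_congr rfl fun j _ => ?_
      ring
    have hS : ∑ i, ∑ j, (Real.log (Z t i j) - Real.log (W i j)) * (Y i j - Z t i j) =
        -t * ∑ i, ∑ j, (Real.log (Z t i j) - Real.log (W i j)) * (X i j - Y i j) := by
      simp only [Finset.mul_sum]
      refine Finset.sum_congr rfl fun i _ => Finset.sum_congr rfl fun j _ => ?_
      linear_combination -(Real.log (Z t i j) - Real.log (W i j)) * hZ t i j
    have h3 := bregman_three_point Y (Z t) W
    rw [hS] at h3
    have h := hmin _ hZP
    rw [h3, hC] at h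
    have hnn := mul_nonneg hη.le (bregman_nonneg hY hZpos)
    refine nonneg_of_mul_nonneg_right (b := g t) (a := t) ?_ ht0
    simp only [g]
    linarith
  rw [← hg0]
  exact ge_of_tendsto (hcont.tendsto.mono_left nhdsWithin_le_nhds) hpos

end

/-- Fejér-type monotonicity of the Bregman distance to any optimal solution:
if `X^{k+1}` minimizes `X ↦ ⟨C,X⟩ + η D_φ(X, X^k)` over `𝒫` and `X*` minimizes
`⟨C,·⟩` over `𝒫`, then `D_φ(X*, X^{k+1}) ≤ D_φ(X*, X^k)`. -/
theorem stmt_5 {m n : ℕ} (hm : 0 < m) (hn : 0 < n)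
    (a : Fin m → ℝ) (b : Fin n → ℝ)
    (ha : ∀ i, 0 < a i) (hb : ∀ j, 0 < b j)
    (hasum : ∑ i, a i = 1) (hbsum : ∑ j, b j = 1)
    (C : Matrix (Fin m) (Fin n) ℝ) (η : ℝ) (hη : 0 < η)
    (Xk Xkp1 Xstar : Matrix (Fin m) (Fin n) ℝ)
    (hXkP : Xk ∈ Pset a b) (hXkpos : ∀ i j, 0 < Xk i j)
    (hXkp1P : Xkp1 ∈ Pset a b) (hXkp1pos : ∀ i j, 0 < Xkp1 i j)
    (hmin : ∀ X ∈ Pset a b,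
      inprod C Xkp1 + η * bregman Xkp1 Xk ≤ inprod C X + η * bregman X Xk)
    (hXstarP : Xstar ∈ Pset a b)
    (hXstarmin : ∀ X ∈ Pset a b, inprod C Xstar ≤ inprod C X) :
    bregman Xstar Xkp1 ≤ bregman Xstar Xk := by
  have hvar := bregman_prox_variational hη hXkp1P hXkp1pos hmin hXstarP
  have hle := hXstarmin _ hXkp1P
  have hS := nonneg_of_mul_nonneg_right
    (show 0 ≤ η * ∑ i, ∑ j, (Real.log (Xkp1 i j) - Real.log (Xk i j)) *
      (Xstar i j - Xkp1 i j) by linarith) hη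
  have hnn := bregman_nonneg hXkp1pos hXkpos
  rw [bregman_three_point Xstar Xkp1 Xk]
  linarith
end

section
/- Assume some extreme point v of 𝒫 satisfies ⟨C,v⟩ > c*, so that Δ > 0 is defined. For each η > 0 let X*(η) be the unique minimizer of X ↦ ⟨C,X⟩ + η·Σ_{i,j} X_{ij} log X_{ij} over 𝒫. Then min_{X∈𝒳} ‖X*(η) − X‖_1 → 0 as η → 0⁺; in particular, every limit point of X*(η) as η → 0⁺ is a minimizer of ⟨C,·⟩ over 𝒫. -/
open scoped BigOperators

lemma continuous_inprod {m n : ℕ} (C : Matrix (Fin m) (Fin n) ℝ) :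
    Continuous (fun X => inprod C X) := by
  unfold inprod
  fun_prop

lemma isClosed_Pset {m n : ℕ} (a : Fin m → ℝ) (b : Fin n → ℝ) : IsClosed (Pset a b) := by
  have h : Pset a b = (⋂ i, ⋂ j, {X : Matrix (Fin m) (Fin n) ℝ | 0 ≤ X i j}) ∩
      ((⋂ i, {X | ∑ j, X i j = a i}) ∩ (⋂ j, {X | ∑ i, X i j = b j})) := by
    ext X
    simp [Pset]
  rw [h]
  refine IsClosed.inter ?_ (IsClosed.inter ?_ ?_)
  · exact isClosed_iInter fun i => isClosed_iInter fun j =>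
      isClosed_le continuous_const (by fun_prop)
  · exact isClosed_iInter fun i => isClosed_eq (by fun_prop) continuous_const
  · exact isClosed_iInter fun j => isClosed_eq (by fun_prop) continuous_const

lemma isCompact_Pset {m n : ℕ} (a : Fin m → ℝ) (b : Fin n → ℝ) : IsCompact (Pset a b) := by
  have hK : IsCompact (Set.univ.pi fun i => Set.univ.pi fun _ : Fin n => Set.Icc 0 (a i)) :=
    isCompact_univ_pi fun i => isCompact_univ_pi fun _ => isCompact_Icc
  refine hK.of_isClosed_subset (isClosed_Pset a b) ?_
  rintro X ⟨h0, hr, -⟩ i - j -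
  refine ⟨h0 i j, ?_⟩
  rw [← hr i]
  exact Finset.single_le_sum (f := fun j => X i j) (fun k _ => h0 i k) (Finset.mem_univ j)

/-- Minimizers of a vanishing bounded perturbation of `f` on `s` have `f`-values tending to the
minimum of `f` on `s`. -/
lemma tendsto_of_perturbed_minimizers {E : Type*} {s : Set E} {f h : E → ℝ} {c M : ℝ}
    (hc : IsLeast (f '' s) c) (hM : ∀ x ∈ s, |h x| ≤ M) {x : ℝ → E}
    (hx : ∀ η > (0 : ℝ), x η ∈ s)
    (hmin : ∀ η > (0 : ℝ), ∀ y ∈ s, f (x η) + η * h (x η) ≤ f y + η * h y) :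
    Filter.Tendsto (fun η => f (x η)) (nhdsWithin 0 (Set.Ioi 0)) (nhds c) := by
  obtain ⟨⟨y, hy, hyc⟩, hlb⟩ := hc
  have hupper : Filter.Tendsto (fun η : ℝ => c + η * (2 * M))
      (nhdsWithin 0 (Set.Ioi 0)) (nhds c) := by
    have : Continuous (fun η : ℝ => c + η * (2 * M)) := by fun_prop
    simpa using (this.tendsto 0).mono_left nhdsWithin_le_nhds
  refine tendsto_of_tendsto_of_tendsto_of_le_of_le' tendsto_const_nhds hupper ?_ ?_
  · filter_upwards [self_mem_nhdsWithin] with η hη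
    exact hlb ⟨x η, hx η hη, rfl⟩
  · filter_upwards [self_mem_nhdsWithin] with η hη
    have h1 := hmin η hη y hy
    have h2 := abs_le.1 (hM _ (hx η hη))
    have h3 := abs_le.1 (hM _ hy)
    have h4 : η * (h y - h (x η)) ≤ η * (2 * M) :=
      mul_le_mul_of_nonneg_left (by linarith) (le_of_lt hη)
    linarith

/-- On a compact set, points whose `f`-values tend to the minimum of `f` approach the set of
minimizers, for any continuous separation function `d`. -/
lemma eventually_exists_minimizer_lt {E ι : Type*} [TopologicalSpace E] {s : Set E}
    (hs : IsCompact s) {f : E → ℝ} (hf : Continuous f) {c : ℝ} (hc : IsLeast (f '' s) c)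
    {d : E → E → ℝ} (hd : ∀ y, Continuous fun x => d x y) (hd0 : ∀ x, d x x = 0)
    {l : Filter ι} {x : ι → E} (hx : ∀ᶠ t in l, x t ∈ s)
    (hfx : Filter.Tendsto (fun t => f (x t)) l (nhds c)) {ε : ℝ} (hε : 0 < ε) :
    ∀ᶠ t in l, ∃ y ∈ s, f y = c ∧ d (x t) y < ε := by
  set K : Set E := s ∩ ⋂ y ∈ {y | y ∈ s ∧ f y = c}, {x | ε ≤ d x y} with hKdef
  have hK : IsCompact K := hs.inter_right <|
    isClosed_biInter fun y _ => isClosed_le continuous_const (hd y)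
  have hfar : ∀ t, x t ∈ s → x t ∉ K → ∃ y ∈ s, f y = c ∧ d (x t) y < ε := by
    intro t ht hxK
    by_contra! hcon
    exact hxK ⟨ht, Set.mem_iInter₂.2 fun y hy => hcon y hy.1 hy.2⟩
  rcases K.eq_empty_or_nonempty with hemp | hne
  · filter_upwards [hx] with t ht
    exact hfar t ht (by simp [hemp])
  · obtain ⟨z, hzK, hz⟩ := hK.exists_isMinOn hne hf.continuousOn
    have hcz : c < f z := by
      refine lt_of_le_of_ne (hc.2 ⟨z, hzK.1, rfl⟩) fun h => ?_
      have := Set.mem_iInter₂.1 hzK.2 z ⟨hzK.1, h.symm⟩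
      rw [Set.mem_ofPred_eq, hd0] at this
      linarith
    filter_upwards [hx, hfx.eventually_lt_const hcz] with t ht hlt
    exact hfar t ht fun hxK => absurd (hz hxK) (not_le.2 hlt)

/-- As `η → 0⁺`, the ℓ1-distance from the unique entropic minimizer `X*(η)` to the
optimal face `𝒳 = {X ∈ 𝒫 : ⟨C,X⟩ = c*}` tends to `0`; in particular, every limit
point of `X*(η)` as `η → 0⁺` is a minimizer of `⟨C,·⟩` over `𝒫`. -/
theorem stmt_19 {m n : ℕ} (hm : 0 < m) (hn : 0 < n)
    (a : Fin m → ℝ) (b : Fin n → ℝ)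
    (ha : ∀ i, 0 < a i) (hb : ∀ j, 0 < b j)
    (hasum : ∑ i, a i = 1) (hbsum : ∑ j, b j = 1)
    (C : Matrix (Fin m) (Fin n) ℝ)
    (cstar : ℝ) (hc : IsLeast ((fun X => inprod C X) '' Pset a b) cstar)
    (hext : ∃ v ∈ Set.extremePoints ℝ (Pset a b), cstar < inprod C v)
    (Xs : ℝ → Matrix (Fin m) (Fin n) ℝ)
    (hXsP : ∀ η > (0 : ℝ), Xs η ∈ Pset a b)
    (hXsmin : ∀ η > (0 : ℝ), ∀ X ∈ Pset a b,
      inprod C (Xs η) + η * ∑ i, ∑ j, Xs η i j * Real.log (Xs η i j)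
        ≤ inprod C X + η * ∑ i, ∑ j, X i j * Real.log (X i j))
    (hXsuniq : ∀ η > (0 : ℝ), ∀ Y ∈ Pset a b,
      (∀ X ∈ Pset a b,
        inprod C Y + η * ∑ i, ∑ j, Y i j * Real.log (Y i j)
          ≤ inprod C X + η * ∑ i, ∑ j, X i j * Real.log (X i j)) → Y = Xs η) :
    Filter.Tendsto
      (fun η : ℝ => sInf {d : ℝ | ∃ X ∈ Pset a b,
        inprod C X = cstar ∧ d = ∑ i, ∑ j, |Xs η i j - X i j|})
      (nhdsWithin 0 (Set.Ioi 0)) (nhds 0) ∧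
    ∀ L : Matrix (Fin m) (Fin n) ℝ,
      MapClusterPt L (nhdsWithin 0 (Set.Ioi 0)) Xs →
      L ∈ Pset a b ∧ inprod C L = cstar := by
  have hcont : Continuous fun X : Matrix (Fin m) (Fin n) ℝ =>
      ∑ i, ∑ j, X i j * Real.log (X i j) :=
    continuous_finsetSum _ fun i _ => continuous_finsetSum _ fun j _ =>
      Real.continuous_mul_log.comp (by fun_prop)
  obtain ⟨M, hM⟩ := (isCompact_Pset a b).exists_bound_of_continuousOn hcont.continuousOn
  have hval : Filter.Tendsto (fun η => inprod C (Xs η)) (nhdsWithin 0 (Set.Ioi 0))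
      (nhds cstar) :=
    tendsto_of_perturbed_minimizers hc hM hXsP hXsmin
  have hmem : ∀ᶠ η in nhdsWithin (0 : ℝ) (Set.Ioi 0), Xs η ∈ Pset a b := by
    filter_upwards [self_mem_nhdsWithin] with η hη using hXsP η hη
  constructor
  · rw [tendsto_order]
    have hnonneg : ∀ η, ∀ r ∈ {d : ℝ | ∃ X ∈ Pset a b,
        inprod C X = cstar ∧ d = ∑ i, ∑ j, |Xs η i j - X i j|}, 0 ≤ r := by
      rintro η r ⟨X, -, -, rfl⟩
      positivity
    refine ⟨fun r hr => Filter.Eventually.of_forall fun η =>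
      hr.trans_le (Real.sInf_nonneg (hnonneg η)), fun ε hε => ?_⟩
    filter_upwards [eventually_exists_minimizer_lt (isCompact_Pset a b) (continuous_inprod C) hc
      (d := fun X Y => ∑ i, ∑ j, |X i j - Y i j|) (fun Y => by fun_prop) (fun X => by simp)
      hmem hval hε] with η hη
    obtain ⟨Y, hY, hYc, hlt⟩ := hη
    exact (csInf_le ⟨0, hnonneg η⟩ ⟨Y, hY, hYc, rfl⟩).trans_lt hlt
  · intro L hL
    refine ⟨(isClosed_Pset a b).mem_of_mapClusterPt hL hmem, ?_⟩
    have hcl : MapClusterPt (inprod C L) (nhdsWithin 0 (Set.Ioi 0)) fun η => inprod C (Xs η) :=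
      MapClusterPt.continuousAt_comp (continuous_inprod C).continuousAt hL
    exact eq_of_nhds_neBot (hcl.clusterPt.mono hval)
end
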